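/- (D−1)-loop melon integral: for complex exponents w₁,…,w_D (wℓ = sℓ + s̄ℓ) in the domain of absolute convergence, and P > 0, the iterated integral M_{D−1}(P) = ∫∏_{ℓ=1}^{D−1}[d³qℓ/(2π)³ |qℓ|^{−2wℓ}] · |P − Σ_{i=1}^{D−1} qᵢ|^{−2w_D} equals P^{3(D−1)−2W}/(4π)^{3(D−1)/2} · Γ(W − 3(D−1)/2)/Γ(3D/2 − W) · ∏_{ℓ=1}^{D} Γ(3/2 − wℓ)/Γ(wℓ), where W = Σ_{ℓ=1}^D wℓ. -/

import Mathlib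

open MeasureTheory

lemma cpow_pos_exp {x : ℝ} (hx : 0 < x) (z : ℂ) :
    (x : ℂ) ^ z = Complex.exp ((Real.log x : ℂ) * z) := by
  rw [Complex.cpow_def_of_ne_zero (by exact_mod_cast hx.ne'), Complex.ofReal_log hx.le]

lemma beta_Ioi {p q : ℂ} (hp : 0 < p.re) (hq : 0 < q.re) :
    IntegrableOn (fun y : ℝ => (y : ℂ) ^ (p - 1) * ((1 + y : ℝ) : ℂ) ^ (-(p + q))) (Set.Ioi 0) ∧
    ∫ y in Set.Ioi (0 : ℝ), (y : ℂ) ^ (p - 1) * ((1 + y : ℝ) : ℂ) ^ (-(p + q)) =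
      Complex.Gamma p * Complex.Gamma q / Complex.Gamma (p + q) := by
  have himg : (fun y : ℝ => y / (1 + y)) '' Set.Ioi 0 = Set.Ioo 0 1 := by
    ext x
    constructor
    · rintro ⟨y, hy, rfl⟩
      have hy : 0 < y := hy
      refine ⟨by positivity, ?_⟩
      show y / (1 + y) < 1
      rw [div_lt_one (by positivity)]; linarith
    · rintro ⟨h0, h1⟩
      have : 0 < 1 - x := by linarith
      refine ⟨x / (1 - x), ?_, ?_⟩
      · show 0 < x / (1 - x)
        positivity
      · show x / (1 - x) / (1 + x / (1 - x)) = x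
        field_simp
        ring
  have hder : ∀ x ∈ Set.Ioi (0 : ℝ), HasDerivWithinAt (fun y : ℝ => y / (1 + y))
      (1 / (1 + x) ^ 2) (Set.Ioi 0) x := by
    intro x hx
    have hx : 0 < x := hx
    have h := ((hasDerivAt_id x).div ((hasDerivAt_id x).const_add 1)
      (by simp only [id]; positivity)).hasDerivWithinAt (s := Set.Ioi 0)
    exact h.congr_deriv (by simp)
  have hinj : Set.InjOn (fun y : ℝ => y / (1 + y)) (Set.Ioi 0) := by
    intro x hx y hy h
    have hx : 0 < x := hx
    have hy : 0 < y := hy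
    simp only at h
    rw [div_eq_div_iff (by positivity) (by positivity)] at h
    linarith
  let g : ℝ → ℂ := fun x => (x : ℂ) ^ (p - 1) * (1 - (x : ℂ)) ^ (q - 1)
  have hpt : ∀ y ∈ Set.Ioi (0 : ℝ), |1 / (1 + y) ^ 2| • g (y / (1 + y)) =
      (y : ℂ) ^ (p - 1) * ((1 + y : ℝ) : ℂ) ^ (-(p + q)) := by
    intro y hy
    have hy : 0 < y := hy
    have h1 : (0 : ℝ) < 1 + y := by positivity
    have e1 : (1 : ℂ) - ((y / (1 + y) : ℝ) : ℂ) = (((1 + y)⁻¹ : ℝ) : ℂ) := by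
      rw [← Complex.ofReal_one, ← Complex.ofReal_sub]
      congr 1
      field_simp
      ring
    have e2 : ((|1 / (1 + y) ^ 2| : ℝ) : ℂ) = Complex.exp ((Real.log (1 + y) : ℂ) * (-2)) := by
      rw [abs_of_pos (by positivity), ← cpow_pos_exp h1, Complex.cpow_neg]
      push_cast
      norm_cast
      simp
    simp only [g]
    rw [Complex.real_smul, e1, e2, cpow_pos_exp (by positivity), cpow_pos_exp (by positivity),
      cpow_pos_exp hy, cpow_pos_exp h1, Real.log_div hy.ne' h1.ne', Real.log_inv,
      ← Complex.exp_add, ← Complex.exp_add, ← Complex.exp_add]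
    congr 1
    push_cast
    ring
  have hI := integrableOn_image_iff_integrableOn_abs_deriv_smul measurableSet_Ioi hder hinj g
  have hE := integral_image_eq_integral_abs_deriv_smul measurableSet_Ioi hder hinj g
  rw [himg] at hI hE
  rw [integrableOn_congr_fun hpt measurableSet_Ioi] at hI
  rw [setIntegral_congr_fun measurableSet_Ioi hpt] at hE
  refine ⟨hI.1 ?_, ?_⟩
  · have := Complex.betaIntegral_convergent hp hq
    rw [intervalIntegrable_iff_integrableOn_Ioo_of_le zero_le_one] at this
    exact this
  · rw [← hE, Complex.Gamma_mul_Gamma_eq_betaIntegral hp hq, mul_div_cancel_left₀ _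
      (Complex.Gamma_ne_zero_of_re_pos (by simp; linarith)), Complex.betaIntegral,
      intervalIntegral.integral_of_le zero_le_one, integral_Ioc_eq_integral_Ioo]

/-- Feynman parametrisation. -/
lemma feynman {a b : ℂ} (ha : 0 < a.re) (hb : 0 < b.re) {A B : ℝ} (hA : 0 < A) (hB : 0 < B) :
    IntegrableOn (fun y : ℝ => (y : ℂ) ^ (b - 1) * ((A + y * B : ℝ) : ℂ) ^ (-(a + b)))
      (Set.Ioi 0) ∧
    ∫ y in Set.Ioi (0 : ℝ), (y : ℂ) ^ (b - 1) * ((A + y * B : ℝ) : ℂ) ^ (-(a + b)) =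
      (A : ℂ) ^ (-a) * (B : ℂ) ^ (-b) *
      (Complex.Gamma a * Complex.Gamma b / Complex.Gamma (a + b)) := by
  obtain ⟨hI, hE⟩ := beta_Ioi hb ha
  let g : ℝ → ℂ := fun y => (y : ℂ) ^ (b - 1) * ((1 + y : ℝ) : ℂ) ^ (-(b + a))
  let c : ℂ := (A : ℂ) ^ (-(a + b)) * ((A / B : ℝ) : ℂ) ^ (b - 1)
  have hpt : ∀ y ∈ Set.Ioi (0 : ℝ), c * g (B / A * y) =
      (y : ℂ) ^ (b - 1) * ((A + y * B : ℝ) : ℂ) ^ (-(a + b)) := by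
    intro y hy
    have hy : 0 < y := hy
    have e : A + y * B = A * (1 + B / A * y) := by field_simp
    simp only [c, g]
    rw [e, cpow_pos_exp hA, cpow_pos_exp (by positivity), cpow_pos_exp (by positivity),
      cpow_pos_exp (by positivity), cpow_pos_exp hy, cpow_pos_exp (by positivity),
      Real.log_mul hA.ne' (by positivity), Real.log_mul (by positivity) hy.ne',
      Real.log_div hB.ne' hA.ne', Real.log_div hA.ne' hB.ne']
    simp only [← Complex.exp_add]
    congr 1
    push_cast
    ring
  have hBA : 0 < B / A := by positivity
  have h0 : IntegrableOn (fun y => g (B / A * y)) (Set.Ioi 0) := by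
    rw [integrableOn_Ioi_comp_mul_left_iff g 0 hBA, mul_zero]
    exact hI
  have h1 := integral_comp_mul_left_Ioi g 0 hBA
  rw [mul_zero] at h1
  refine ⟨(integrableOn_congr_fun hpt measurableSet_Ioi).1 (h0.const_mul c), ?_⟩
  rw [← setIntegral_congr_fun measurableSet_Ioi hpt, integral_const_mul, h1]
  simp only [g]
  rw [hE]
  simp only [c]
  rw [Complex.real_smul, add_comm b a, mul_comm (Complex.Gamma b), ← mul_assoc]
  congr 1
  have e2 : (((B / A)⁻¹ : ℝ) : ℂ) = Complex.exp ((Real.log (A / B) : ℂ)) := by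
    rw [← Complex.ofReal_exp, Real.exp_log (by positivity), inv_div]
  rw [e2, cpow_pos_exp hA, cpow_pos_exp hA, cpow_pos_exp hB, cpow_pos_exp (by positivity),
    Real.log_div hA.ne' hB.ne']
  simp only [← Complex.exp_add]
  congr 1
  push_cast
  ring


/-- The massive tadpole integral. -/
lemma tadpole {s : ℂ} (hs : 3 / 2 < s.re) {m c : ℝ} (hm : 0 < m) (hc : 0 < c) :
    ∫ q : (EuclideanSpace ℝ (Fin 3)), ((m + c * ‖q‖ ^ 2 : ℝ) : ℂ) ^ (-s) =
      (Real.pi : ℂ) ^ (3 / 2 : ℂ) * (m : ℂ) ^ (3 / 2 - s) * (c : ℂ) ^ (-(3 / 2) : ℂ) *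
        (Complex.Gamma (s - 3 / 2) / Complex.Gamma s) := by
  have h := integral_fun_norm_addHaar (volume : Measure (EuclideanSpace ℝ (Fin 3)))
    (fun r : ℝ => ((m + c * r ^ 2 : ℝ) : ℂ) ^ (-s))
  rw [h]
  have hf := feynman (a := s - 3 / 2) (b := 3 / 2) (by simp; linarith) (by norm_num) hm hc
  have h2 := integral_comp_rpow_Ioi
    (fun v : ℝ => (1 / 2 : ℂ) * ((v : ℂ) ^ (3 / 2 - 1 : ℂ) * ((m + v * c : ℝ) : ℂ) ^ (-(s - 3 / 2 + 3 / 2))))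
    (two_ne_zero (α := ℝ))
  rw [integral_const_mul, hf.2] at h2
  have h3 : ∫ r in Set.Ioi (0 : ℝ), r ^ (Module.finrank ℝ (EuclideanSpace ℝ (Fin 3)) - 1) • ((m + c * r ^ 2 : ℝ) : ℂ) ^ (-s)
     = ∫ x in Set.Ioi (0 : ℝ), (|(2 : ℝ)| * x ^ ((2 : ℝ) - 1)) •
      ((1 / 2 : ℂ) * (((x ^ (2 : ℝ) : ℝ) : ℂ) ^ (3 / 2 - 1 : ℂ) *
        ((m + (x ^ (2 : ℝ)) * c : ℝ) : ℂ) ^ (-(s - 3 / 2 + 3 / 2)))) := by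
    refine setIntegral_congr_fun measurableSet_Ioi ?_
    intro x hx
    have hx : 0 < x := hx
    have e1 : (((x ^ 2 : ℝ)) : ℂ) ^ (3 / 2 - 1 : ℂ) = x := by
      rw [cpow_pos_exp (by positivity), Real.log_pow]
      rw [show (((2 : ℕ) * Real.log x : ℝ) : ℂ) * (3 / 2 - 1) = (Real.log x : ℂ) by push_cast; ring,
        ← Complex.ofReal_exp, Real.exp_log hx]
    simp only [Real.rpow_two]
    rw [e1]
    norm_num
    rw [mul_comm (c : ℂ)]
    ring
  rw [h3, h2]
  have hvol : (volume : Measure (EuclideanSpace ℝ (Fin 3))).real (Metric.ball 0 1) = Real.pi * 4 / 3 := by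
    rw [Measure.real, EuclideanSpace.volume_ball_fin_three]
    simp
    positivity
  rw [hvol]
  have hG : Complex.Gamma (3 / 2) = (Real.pi : ℂ) ^ (1 / 2 : ℂ) / 2 := by
    have := Complex.Gamma_add_one (1 / 2) (by norm_num)
    rw [Complex.Gamma_one_half_eq] at this
    rw [show (3 / 2 : ℂ) = 1 / 2 + 1 by norm_num, this]
    ring
  have hpi : (Real.pi : ℂ) ^ (3 / 2 : ℂ) = Real.pi * (Real.pi : ℂ) ^ (1 / 2 : ℂ) := by
    rw [show (3 / 2 : ℂ) = 1 + 1 / 2 by norm_num, Complex.cpow_add _ _ (by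
      exact_mod_cast Real.pi_ne_zero), Complex.cpow_one]
  rw [hG, hpi]
  simp only [finrank_euclideanSpace, Fintype.card_fin]
  rw [show s - 3 / 2 + 3 / 2 = s by ring, show -(s - 3 / 2) = 3 / 2 - s by ring]
  simp only [Complex.real_smul, nsmul_eq_mul]
  push_cast
  ring

lemma cpow_sq {x : ℝ} (hx : 0 < x) (a : ℂ) : ((x ^ 2 : ℝ) : ℂ) ^ (-a) = (x : ℂ) ^ (-2 * a) := by
  rw [cpow_pos_exp (by positivity), cpow_pos_exp hx, Real.log_pow]
  congr 1
  push_cast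
  ring

lemma norm_bub {x y : ℝ} (hx : 0 < x) (hy : 0 < y) (a b : ℂ) :
    ‖(x : ℂ) ^ (-2 * a) * (y : ℂ) ^ (-2 * b)‖ = x ^ (-2 * a.re) * y ^ (-2 * b.re) := by
  rw [norm_mul, Complex.norm_cpow_eq_rpow_re_of_pos hx, Complex.norm_cpow_eq_rpow_re_of_pos hy]
  simp

lemma bubble_ne {a b : ℂ} {P : (EuclideanSpace ℝ (Fin 3))}
    (hint : Integrable (fun q : (EuclideanSpace ℝ (Fin 3)) => ((‖q‖ : ℝ) : ℂ) ^ (-2 * a) * ((‖P - q‖ : ℝ) : ℂ) ^ (-2 * b))) :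
    P ≠ 0 := by
  rintro rfl
  have h1 : Integrable (fun q : (EuclideanSpace ℝ (Fin 3)) => ((‖q‖ : ℝ) : ℂ) ^ (-2 * a) * ((‖q‖ : ℝ) : ℂ) ^ (-2 * b)) := by
    simpa using hint
  rw [integrable_fun_norm_addHaar (volume : Measure (EuclideanSpace ℝ (Fin 3)))
    (f := fun r : ℝ => (r : ℂ) ^ (-2 * a) * (r : ℂ) ^ (-2 * b))] at h1
  have h2 := h1.norm
  refine not_integrableOn_Ioi_rpow (2 + (-2 * a.re + -2 * b.re)) ?_
  refine (integrableOn_congr_fun ?_ measurableSet_Ioi).1 h2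
  intro r hr
  have hr : 0 < r := hr
  simp only [norm_smul]
  rw [norm_bub hr hr, Real.rpow_add hr, Real.rpow_add hr]
  simp

lemma bubble_dim {a b : ℂ} (hb : 0 < b.re) {P : (EuclideanSpace ℝ (Fin 3))}
    (hint : Integrable (fun q : (EuclideanSpace ℝ (Fin 3)) => ((‖q‖ : ℝ) : ℂ) ^ (-2 * a) * ((‖P - q‖ : ℝ) : ℂ) ^ (-2 * b))) :
    3 / 2 < a.re + b.re := by
  by_contra! hab
  let R := ‖P‖ + 1
  have hR : 1 ≤ R := by simp [R]
  let h : ℝ → ℝ := (Set.Ioi R).indicator (fun r => r ^ (-3 : ℝ))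
  have hmeas : Measurable h := (by fun_prop : Measurable (fun r : ℝ => r ^ (-3 : ℝ))).indicator measurableSet_Ioi
  have hI : Integrable (fun q : (EuclideanSpace ℝ (Fin 3)) => h ‖q‖) := by
    refine (hint.norm.const_mul (2 ^ (2 * b.re))).mono' (hmeas.comp measurable_norm).aestronglyMeasurable
      (Filter.Eventually.of_forall fun q => ?_)
    by_cases hq : R < ‖q‖
    · have hq0 : 1 < ‖q‖ := by linarith
      have hq' : 0 < ‖q‖ := by linarith
      have hd : 0 < ‖P - q‖ := by
        have := norm_sub_norm_le q P
        rw [norm_sub_rev] at this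
        simp only [R] at hq
        linarith
      have hd2 : ‖P - q‖ ≤ 2 * ‖q‖ := by
        have := norm_sub_le P q
        simp only [R] at hq
        linarith
      simp only [h]
      rw [Set.indicator_of_mem (show ‖q‖ ∈ Set.Ioi R from hq), norm_bub hq' hd,
        Real.norm_of_nonneg (by positivity)]
      have e1 : (2 * ‖q‖) ^ (-2 * b.re) ≤ ‖P - q‖ ^ (-2 * b.re) :=
        Real.rpow_le_rpow_of_nonpos hd hd2 (by linarith)
      have e2 : ‖q‖ ^ (-3 : ℝ) ≤ ‖q‖ ^ (-2 * a.re + -2 * b.re) :=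
        Real.rpow_le_rpow_of_exponent_le hq0.le (by linarith)
      calc ‖q‖ ^ (-3 : ℝ) ≤ ‖q‖ ^ (-2 * a.re + -2 * b.re) := e2
        _ = 2 ^ (2 * b.re) * (‖q‖ ^ (-2 * a.re) * (2 * ‖q‖) ^ (-2 * b.re)) := by
          rw [Real.rpow_add hq', Real.mul_rpow (by norm_num) hq'.le]
          have : (2 : ℝ) ^ (2 * b.re) * 2 ^ (-2 * b.re) = 1 := by
            rw [← Real.rpow_add (by norm_num)]; simp
          linear_combination (-(‖q‖ ^ (-2 * a.re) * ‖q‖ ^ (-2 * b.re))) * this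
        _ ≤ _ := by gcongr
    · simp only [h]
      rw [Set.indicator_of_notMem (show ‖q‖ ∉ Set.Ioi R from hq), norm_zero]
      positivity
  rw [integrable_fun_norm_addHaar] at hI
  have hI2 := hI.mono_set (Set.Ioi_subset_Ioi (by linarith : (0 : ℝ) ≤ R))
  refine not_integrableOn_Ioi_inv (a := R) ?_
  refine (integrableOn_congr_fun ?_ measurableSet_Ioi).1 hI2
  intro r hr
  have hr0 : 0 < r := by have : R < r := hr; linarith
  simp only [h]
  rw [Set.indicator_of_mem hr, smul_eq_mul, Real.rpow_neg hr0.le]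
  simp
  field_simp

noncomputable def GG (x : ℂ) : ℂ := Complex.Gamma (3 / 2 - x) / Complex.Gamma x

lemma GG_ne {x : ℂ} (h0 : 0 < x.re) (h1 : x.re < 3 / 2) : GG x ≠ 0 :=
  div_ne_zero (Complex.Gamma_ne_zero_of_re_pos (by simp; linarith))
    (Complex.Gamma_ne_zero_of_re_pos h0)

lemma bubble {a b : ℂ} (ha : 0 < a.re) (ha' : a.re < 3 / 2) (hb : 0 < b.re) (hb' : b.re < 3 / 2)
    {P : (EuclideanSpace ℝ (Fin 3))}
    (hint : Integrable (fun q : (EuclideanSpace ℝ (Fin 3)) => ((‖q‖ : ℝ) : ℂ) ^ (-2 * a) * ((‖P - q‖ : ℝ) : ℂ) ^ (-2 * b))) :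
    ∫ q : (EuclideanSpace ℝ (Fin 3)), ((‖q‖ : ℝ) : ℂ) ^ (-2 * a) * ((‖P - q‖ : ℝ) : ℂ) ^ (-2 * b) =
      (Real.pi : ℂ) ^ (3 / 2 : ℂ) * (GG a * GG b / GG (a + b - 3 / 2)) *
        ((‖P‖ : ℝ) : ℂ) ^ (-2 * (a + b - 3 / 2)) := by
  have hP := bubble_ne hint
  have hs := bubble_dim hb hint
  have hP' : 0 < ‖P‖ := norm_pos_iff.2 hP
  let F : (EuclideanSpace ℝ (Fin 3)) → ℝ → ℂ := fun q y =>
    (y : ℂ) ^ (b - 1) * ((‖q‖ ^ 2 + y * ‖P - q‖ ^ 2 : ℝ) : ℂ) ^ (-(a + b))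
  have hae : ∀ᵐ q : (EuclideanSpace ℝ (Fin 3)), q ≠ 0 ∧ q ≠ P := by
    filter_upwards [Measure.ae_ne volume (0 : (EuclideanSpace ℝ (Fin 3))), Measure.ae_ne volume P] with q h1 h2
    exact ⟨h1, h2⟩
  have hfey : ∀ q : (EuclideanSpace ℝ (Fin 3)), q ≠ 0 ∧ q ≠ P → IntegrableOn (F q) (Set.Ioi 0) ∧
      ∫ y in Set.Ioi (0 : ℝ), F q y = ((‖q‖ : ℝ) : ℂ) ^ (-2 * a) * ((‖P - q‖ : ℝ) : ℂ) ^ (-2 * b) *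
        (Complex.Gamma a * Complex.Gamma b / Complex.Gamma (a + b)) := by
    rintro q ⟨h1, h2⟩
    have h1' : 0 < ‖q‖ := norm_pos_iff.2 h1
    have h2' : 0 < ‖P - q‖ := norm_pos_iff.2 (sub_ne_zero.2 h2.symm)
    have := feynman ha hb (pow_pos h1' 2) (pow_pos h2' 2)
    rw [cpow_sq h1', cpow_sq h2'] at this
    exact this
  let C' : ℂ := Complex.Gamma a.re * Complex.Gamma b.re / Complex.Gamma (a.re + b.re)
  have hnorm : ∀ q : (EuclideanSpace ℝ (Fin 3)), q ≠ 0 ∧ q ≠ P → ∫ y in Set.Ioi (0 : ℝ), ‖F q y‖ =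
      ‖C'‖ * ‖((‖q‖ : ℝ) : ℂ) ^ (-2 * a) * ((‖P - q‖ : ℝ) : ℂ) ^ (-2 * b)‖ := by
    rintro q ⟨h1, h2⟩
    have h1' : 0 < ‖q‖ := norm_pos_iff.2 h1
    have h2' : 0 < ‖P - q‖ := norm_pos_iff.2 (sub_ne_zero.2 h2.symm)
    have hf := (feynman (a := (a.re : ℂ)) (b := (b.re : ℂ)) (by simpa using ha) (by simpa using hb)
      (pow_pos h1' 2) (pow_pos h2' 2)).2
    have hpt : ∀ y ∈ Set.Ioi (0 : ℝ), (y : ℂ) ^ ((b.re : ℂ) - 1) *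
        ((‖q‖ ^ 2 + y * ‖P - q‖ ^ 2 : ℝ) : ℂ) ^ (-((a.re : ℂ) + b.re)) = ((‖F q y‖ : ℝ) : ℂ) := by
      intro y hy
      have hy : 0 < y := hy
      have hp : 0 < ‖q‖ ^ 2 + y * ‖P - q‖ ^ 2 := by positivity
      simp only [F]
      rw [norm_mul, Complex.norm_cpow_eq_rpow_re_of_pos hy, Complex.norm_cpow_eq_rpow_re_of_pos hp,
        Complex.ofReal_mul, Complex.ofReal_cpow hy.le, Complex.ofReal_cpow hp.le]
      simp
    rw [setIntegral_congr_fun measurableSet_Ioi hpt, integral_complex_ofReal] at hf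
    have hn := congrArg norm hf
    rw [Complex.norm_real, Real.norm_of_nonneg (integral_nonneg fun _ => norm_nonneg _),
      cpow_sq h1', cpow_sq h2', norm_mul, norm_bub h1' h2'] at hn
    rw [hn, norm_bub h1' h2', mul_comm]
    simp [C']
  have hFm : Measurable (Function.uncurry F) := by
    simp only [F, Function.uncurry_def]
    fun_prop
  have hFint : Integrable (Function.uncurry F)
      ((volume : Measure (EuclideanSpace ℝ (Fin 3))).prod (volume.restrict (Set.Ioi (0 : ℝ)))) := by
    rw [integrable_prod_iff hFm.aestronglyMeasurable]
    constructor
    · filter_upwards [hae] with q hq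
      exact (hfey q hq).1
    · refine (hint.norm.const_mul ‖C'‖).congr ?_
      filter_upwards [hae] with q hq
      exact (hnorm q hq).symm
  have hswap := integral_integral_swap hFint
  rw [integral_congr_ae (g := fun q : (EuclideanSpace ℝ (Fin 3)) => ((‖q‖ : ℝ) : ℂ) ^ (-2 * a) *
    ((‖P - q‖ : ℝ) : ℂ) ^ (-2 * b) * (Complex.Gamma a * Complex.Gamma b / Complex.Gamma (a + b)))
    (by filter_upwards [hae] with q hq using (hfey q hq).2), integral_mul_const] at hswap
  have hinner : ∀ y ∈ Set.Ioi (0 : ℝ), ∫ q : (EuclideanSpace ℝ (Fin 3)), F q y =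
      ((Real.pi : ℂ) ^ (3 / 2 : ℂ) * ((‖P‖ : ℝ) : ℂ) ^ (-2 * (a + b - 3 / 2)) *
        (Complex.Gamma (a + b - 3 / 2) / Complex.Gamma (a + b))) *
      ((y : ℂ) ^ (3 / 2 - a - 1) * ((1 + y : ℝ) : ℂ) ^ (-((3 / 2 - a) + (3 / 2 - b)))) := by
    intro y hy
    have hy : 0 < y := hy
    have hy1 : 0 < 1 + y := by positivity
    have hq : ∀ q : (EuclideanSpace ℝ (Fin 3)), ‖q + (y / (1 + y)) • P‖ ^ 2 + y * ‖P - (q + (y / (1 + y)) • P)‖ ^ 2 =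
        y / (1 + y) * ‖P‖ ^ 2 + (1 + y) * ‖q‖ ^ 2 := by
      intro q
      have e : P - (q + (y / (1 + y)) • P) = (1 / (1 + y)) • P - q := by
        have : (1 : ℝ) / (1 + y) = 1 - y / (1 + y) := by field_simp; ring
        rw [this, sub_smul, one_smul]
        abel
      rw [e, norm_add_sq_real, norm_sub_sq_real, norm_smul, norm_smul, inner_smul_right,
        inner_smul_left, real_inner_comm P q, Real.norm_of_nonneg (by positivity),
        Real.norm_of_nonneg (by positivity)]
      simp only [conj_trivial]
      field_simp
      ring
    simp only [F]
    rw [integral_const_mul, ← integral_add_right_eq_self _ ((y / (1 + y)) • P)]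
    simp only [hq]
    have hm : 0 < y / (1 + y) * ‖P‖ ^ 2 := by positivity
    rw [tadpole (by simpa using hs) hm hy1]
    have key : (y : ℂ) ^ (b - 1) * ((((y / (1 + y) * ‖P‖ ^ 2 : ℝ)) : ℂ) ^ (3 / 2 - (a + b)) *
        ((1 + y : ℝ) : ℂ) ^ (-(3 / 2) : ℂ)) = ((‖P‖ : ℝ) : ℂ) ^ (-2 * (a + b - 3 / 2)) *
        ((y : ℂ) ^ (3 / 2 - a - 1) * ((1 + y : ℝ) : ℂ) ^ (-((3 / 2 - a) + (3 / 2 - b)))) := by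
      rw [cpow_pos_exp hy, cpow_pos_exp hm, cpow_pos_exp hy1, cpow_pos_exp hP', cpow_pos_exp hy,
        cpow_pos_exp hy1, Real.log_mul (by positivity) (by positivity),
        Real.log_div hy.ne' hy1.ne', Real.log_pow]
      simp only [← Complex.exp_add]
      congr 1
      push_cast
      ring
    linear_combination ((Real.pi : ℂ) ^ (3 / 2 : ℂ) *
      (Complex.Gamma (a + b - 3 / 2) / Complex.Gamma (a + b))) * key
  have hbeta := (beta_Ioi (p := 3 / 2 - a) (q := 3 / 2 - b) (by simp; linarith)
    (by simp; linarith)).2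
  rw [setIntegral_congr_fun measurableSet_Ioi hinner, integral_const_mul, hbeta] at hswap
  have n1 : Complex.Gamma a ≠ 0 := Complex.Gamma_ne_zero_of_re_pos ha
  have n2 : Complex.Gamma b ≠ 0 := Complex.Gamma_ne_zero_of_re_pos hb
  have n3 : Complex.Gamma (a + b) ≠ 0 := Complex.Gamma_ne_zero_of_re_pos (by simp; linarith)
  have n4 : Complex.Gamma (a + b - 3 / 2) ≠ 0 := Complex.Gamma_ne_zero_of_re_pos (by simp; linarith)
  have n5 : Complex.Gamma (3 / 2 - a + (3 / 2 - b)) ≠ 0 :=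
    Complex.Gamma_ne_zero_of_re_pos (by simp; linarith)
  unfold GG
  rw [show 3 / 2 - (a + b - 3 / 2) = 3 / 2 - a + (3 / 2 - b) by ring]
  rw [← eq_div_iff (div_ne_zero (mul_ne_zero n1 n2) n3)] at hswap
  rw [hswap]
  field_simp

lemma melon : ∀ (n : ℕ) (w : Fin (n + 1) → ℂ) (_ : ∀ ℓ, 0 < (w ℓ).re ∧ (w ℓ).re < 3 / 2) (P : (EuclideanSpace ℝ (Fin 3)))
    (_ : Integrable (fun q : Fin n → (EuclideanSpace ℝ (Fin 3)) =>
      (∏ ℓ : Fin n, ((‖q ℓ‖ : ℝ) : ℂ) ^ (-2 * w ℓ.castSucc)) *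
        ((‖P - ∑ i, q i‖ : ℝ) : ℂ) ^ (-2 * w (Fin.last n)))),
    ∫ q : Fin n → (EuclideanSpace ℝ (Fin 3)), (∏ ℓ : Fin n, ((‖q ℓ‖ : ℝ) : ℂ) ^ (-2 * w ℓ.castSucc)) *
            ((‖P - ∑ i, q i‖ : ℝ) : ℂ) ^ (-2 * w (Fin.last n)) =
      ((Real.pi : ℂ) ^ (3 / 2 : ℂ)) ^ n * ((‖P‖ : ℝ) : ℂ) ^ (3 * (n : ℂ) - 2 * ∑ ℓ, w ℓ) *
        (∏ ℓ, GG (w ℓ)) / GG ((∑ ℓ, w ℓ) - 3 * (n : ℂ) / 2) := by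
  intro n
  induction n with
  | zero =>
    intro w hw P _
    have h0 := GG_ne (hw 0).1 (hw 0).2
    have hv : (volume : Measure (Fin 0 → (EuclideanSpace ℝ (Fin 3)))) = Measure.dirac default := Measure.pi_of_empty _ _
    rw [hv, integral_dirac]
    simp
    field_simp
  | succ n ih =>
    intro w hw P hint
    set a := w (Fin.last n).castSucc with ha
    set b := w (Fin.last (n + 1)) with hb
    let K : ℂ := (Real.pi : ℂ) ^ (3 / 2 : ℂ) * (GG a * GG b / GG (a + b - 3 / 2))
    let pre : (Fin n → (EuclideanSpace ℝ (Fin 3))) → ℂ := fun q =>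
      ∏ ℓ : Fin n, ((‖q ℓ‖ : ℝ) : ℂ) ^ (-2 * w ℓ.castSucc.castSucc)
    let f : (EuclideanSpace ℝ (Fin 3)) × (Fin n → (EuclideanSpace ℝ (Fin 3))) → ℂ := fun z => pre z.2 *
      (((‖z.1‖ : ℝ) : ℂ) ^ (-2 * a) * ((‖P - ∑ i, z.2 i - z.1‖ : ℝ) : ℂ) ^ (-2 * b))
    have hmp := volume_preserving_piFinSuccAbove (fun _ : Fin (n + 1) => (EuclideanSpace ℝ (Fin 3))) (Fin.last n)
    have hfe : (fun q : Fin (n + 1) → (EuclideanSpace ℝ (Fin 3)) =>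
        (∏ ℓ : Fin (n + 1), ((‖q ℓ‖ : ℝ) : ℂ) ^ (-2 * w ℓ.castSucc)) *
        ((‖P - ∑ i, q i‖ : ℝ) : ℂ) ^ (-2 * b)) =
        f ∘ (MeasurableEquiv.piFinSuccAbove (fun _ : Fin (n + 1) => (EuclideanSpace ℝ (Fin 3))) (Fin.last n)) := by
      funext q
      simp only [f, pre, Function.comp, MeasurableEquiv.piFinSuccAbove_apply]
      rw [Fin.prod_univ_castSucc, Fin.sum_univ_castSucc]
      simp [Fin.insertNthEquiv, Fin.init, sub_sub, mul_assoc, ha]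
    have hfint : Integrable f (volume.prod volume) := by
      rw [hfe] at hint
      exact (hmp.integrable_comp_emb (MeasurableEquiv.measurableEmbedding _)).1 hint
    have hpre : ∀ᵐ q : Fin n → (EuclideanSpace ℝ (Fin 3)), pre q ≠ 0 := by
      have : ∀ᵐ q : Fin n → (EuclideanSpace ℝ (Fin 3)), ∀ i, q i ≠ 0 :=
        ae_all_iff.2 fun i => Measure.ae_eval_ne (fun _ : Fin n => (volume : Measure (EuclideanSpace ℝ (Fin 3)))) i 0
      filter_upwards [this] with q hq
      refine Finset.prod_ne_zero_iff.2 fun i _ => ?_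
      rw [Complex.cpow_def_of_ne_zero (by simpa using hq i)]
      exact Complex.exp_ne_zero _
    have hbub : ∀ᵐ q : Fin n → (EuclideanSpace ℝ (Fin 3)), Integrable (fun x : (EuclideanSpace ℝ (Fin 3)) =>
        ((‖x‖ : ℝ) : ℂ) ^ (-2 * a) * ((‖P - ∑ i, q i - x‖ : ℝ) : ℂ) ^ (-2 * b)) := by
      filter_upwards [hpre, hfint.prod_left_ae] with q hq hq2
      exact (integrable_const_mul_iff (IsUnit.mk0 _ hq) _).1 hq2
    obtain ⟨q0, hq0⟩ := hbub.exists
    obtain ⟨ha0, ha1⟩ := hw (Fin.last n).castSucc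
    obtain ⟨hb0, hb1⟩ := hw (Fin.last (n + 1))
    rw [← ha] at ha0 ha1
    rw [← hb] at hb0 hb1
    have hs := bubble_dim hb0 hq0
    have hG : GG (a + b - 3 / 2) ≠ 0 := GG_ne (by simp; linarith) (by simp; linarith)
    have hK : K ≠ 0 := by
      refine mul_ne_zero ?_ (div_ne_zero (mul_ne_zero (GG_ne ha0 ha1) (GG_ne hb0 hb1)) hG)
      rw [cpow_pos_exp Real.pi_pos]
      exact Complex.exp_ne_zero _
    let w' : Fin (n + 1) → ℂ := Fin.snoc (fun i : Fin n => w i.castSucc.castSucc) (a + b - 3 / 2)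
    have hw'c : ∀ i : Fin n, w' i.castSucc = w i.castSucc.castSucc := fun i => by simp [w']
    have hw'l : w' (Fin.last n) = a + b - 3 / 2 := by simp [w']
    have hinner : ∀ᵐ q : Fin n → (EuclideanSpace ℝ (Fin 3)), ∫ x : (EuclideanSpace ℝ (Fin 3)), f (x, q) =
        K * ((∏ ℓ : Fin n, ((‖q ℓ‖ : ℝ) : ℂ) ^ (-2 * w' ℓ.castSucc)) *
        ((‖P - ∑ i, q i‖ : ℝ) : ℂ) ^ (-2 * w' (Fin.last n))) := by
      filter_upwards [hbub] with q hq
      simp only [f, hw'c, hw'l]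
      rw [integral_const_mul, bubble ha0 ha1 hb0 hb1 hq]
      simp only [pre, K]
      ring
    have hint' : Integrable (fun q : Fin n → (EuclideanSpace ℝ (Fin 3)) =>
        (∏ ℓ : Fin n, ((‖q ℓ‖ : ℝ) : ℂ) ^ (-2 * w' ℓ.castSucc)) *
        ((‖P - ∑ i, q i‖ : ℝ) : ℂ) ^ (-2 * w' (Fin.last n))) :=
      (integrable_const_mul_iff (IsUnit.mk0 _ hK) _).1 (hfint.integral_prod_right.congr hinner)
    have hw' : ∀ ℓ, 0 < (w' ℓ).re ∧ (w' ℓ).re < 3 / 2 := by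
      intro ℓ
      refine Fin.lastCases ?_ (fun i => ?_) ℓ
      · rw [hw'l]
        constructor <;> simp <;> linarith
      · rw [hw'c]
        exact hw _
    have hIH := ih w' hw' P hint'
    have hfull : ∫ q : Fin (n + 1) → (EuclideanSpace ℝ (Fin 3)),
        (∏ ℓ : Fin (n + 1), ((‖q ℓ‖ : ℝ) : ℂ) ^ (-2 * w ℓ.castSucc)) *
        ((‖P - ∑ i, q i‖ : ℝ) : ℂ) ^ (-2 * b) = ∫ z, f z ∂(volume.prod volume) := by
      rw [hfe]
      exact hmp.integral_comp (MeasurableEquiv.measurableEmbedding _) f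
    rw [hfull, integral_prod_symm f hfint, integral_congr_ae hinner, integral_const_mul, hIH]
    have hsum : ∑ ℓ, w' ℓ = ∑ ℓ, w ℓ - 3 / 2 := by
      rw [Fin.sum_univ_castSucc, Fin.sum_univ_castSucc (n := n + 1),
        Fin.sum_univ_castSucc (n := n)]
      simp only [hw'c, hw'l, ← ha, ← hb]
      ring
    have hprod : ∏ ℓ, GG (w ℓ) = (∏ i : Fin n, GG (w i.castSucc.castSucc)) * GG a * GG b := by
      rw [Fin.prod_univ_castSucc, Fin.prod_univ_castSucc]
    have hprod' : ∏ ℓ, GG (w' ℓ) =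
        (∏ i : Fin n, GG (w i.castSucc.castSucc)) * GG (a + b - 3 / 2) := by
      rw [Fin.prod_univ_castSucc]
      simp only [hw'c, hw'l]
    rw [hsum, hprod, hprod']
    simp only [K]
    push_cast
    rw [show 3 * (n : ℂ) - 2 * (∑ ℓ, w ℓ - 3 / 2) = 3 * ((n : ℂ) + 1) - 2 * ∑ ℓ, w ℓ by ring,
      show ∑ ℓ, w ℓ - 3 / 2 - 3 * (n : ℂ) / 2 = ∑ ℓ, w ℓ - 3 * ((n : ℂ) + 1) / 2 by ring, pow_succ]
    generalize GG (∑ ℓ, w ℓ - 3 * ((n : ℂ) + 1) / 2) = X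
    generalize GG (a + b - 3 / 2) = Y at hG ⊢
    field_simp

lemma melon_const (n : ℕ) : (1 / (2 * (Real.pi : ℂ)) ^ 3) ^ n * ((Real.pi : ℂ) ^ (3 / 2 : ℂ)) ^ n =
    1 / (((4 * Real.pi) ^ (3 * (n : ℝ) / 2) : ℝ) : ℂ) := by
  have hpi := Real.pi_pos
  have e1 : (Real.pi : ℂ) ^ (3 / 2 : ℂ) = ((Real.pi ^ (3 / 2 : ℝ) : ℝ) : ℂ) := by
    rw [Complex.ofReal_cpow hpi.le]
    norm_num
  rw [e1, ← mul_pow]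
  have e2 : (4 * Real.pi) ^ (3 * (n : ℝ) / 2) = ((4 * Real.pi) ^ (3 / 2 : ℝ)) ^ n := by
    rw [← Real.rpow_natCast, ← Real.rpow_mul (by positivity)]
    congr 1
    ring
  have e3 : (4 : ℝ) ^ (3 / 2 : ℝ) = 8 := by
    rw [show (4 : ℝ) = 2 ^ (2 : ℝ) by norm_num, ← Real.rpow_mul (by norm_num)]
    norm_num
  have e4 : Real.pi ^ (3 / 2 : ℝ) * Real.pi ^ (3 / 2 : ℝ) = Real.pi ^ 3 := by
    rw [← Real.rpow_add hpi, ← Real.rpow_natCast]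
    norm_num
  rw [e2]
  push_cast
  rw [one_div (_ ^ n), ← inv_pow]
  congr 1
  norm_cast
  rw [Real.mul_rpow (by norm_num) hpi.le, e3]
  have : 0 < Real.pi ^ (3 / 2 : ℝ) := by positivity
  field_simp
  rw [sq, e4]
  ring

theorem stmt7 (n : ℕ) (w : Fin (n + 1) → ℂ)
    (hw : ∀ ℓ, 3 / 4 < (w ℓ).re ∧ (w ℓ).re < 3 / 2)
    (P : EuclideanSpace ℝ (Fin 3)) (hP : P ≠ 0)
    (hint : Integrable (fun q : Fin n → EuclideanSpace ℝ (Fin 3) =>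
      (∏ ℓ : Fin n, ((‖q ℓ‖ : ℝ) : ℂ) ^ (-2 * w ℓ.castSucc)) *
        ((‖P - ∑ i, q i‖ : ℝ) : ℂ) ^ (-2 * w (Fin.last n)))) :
    (1 / (2 * (Real.pi : ℂ)) ^ 3) ^ n *
        ∫ q : Fin n → EuclideanSpace ℝ (Fin 3),
          (∏ ℓ : Fin n, ((‖q ℓ‖ : ℝ) : ℂ) ^ (-2 * w ℓ.castSucc)) *
            ((‖P - ∑ i, q i‖ : ℝ) : ℂ) ^ (-2 * w (Fin.last n))
      = ((‖P‖ : ℝ) : ℂ) ^ (3 * (n : ℂ) - 2 * ∑ ℓ, w ℓ) /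
          (((4 * Real.pi) ^ (3 * (n : ℝ) / 2) : ℝ) : ℂ) *
        (Complex.Gamma ((∑ ℓ, w ℓ) - 3 * (n : ℂ) / 2) /
          Complex.Gamma (3 * ((n : ℂ) + 1) / 2 - ∑ ℓ, w ℓ)) *
        ∏ ℓ : Fin (n + 1), (Complex.Gamma (3 / 2 - w ℓ) / Complex.Gamma (w ℓ)) := by
  have h := melon n w (fun ℓ => ⟨by linarith [(hw ℓ).1], (hw ℓ).2⟩) P hint
  rw [h]
  have hc := melon_const n
  have hG : Complex.Gamma ((∑ ℓ, w ℓ) - 3 * (n : ℂ) / 2) /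
      Complex.Gamma (3 * ((n : ℂ) + 1) / 2 - ∑ ℓ, w ℓ) = (GG ((∑ ℓ, w ℓ) - 3 * (n : ℂ) / 2))⁻¹ := by
    unfold GG
    rw [inv_div]
    congr 2
    ring
  have hp : ∏ ℓ : Fin (n + 1), (Complex.Gamma (3 / 2 - w ℓ) / Complex.Gamma (w ℓ)) =
      ∏ ℓ, GG (w ℓ) := rfl
  rw [hG, hp]
  linear_combination (((‖P‖ : ℝ) : ℂ) ^ (3 * (n : ℂ) - 2 * ∑ ℓ, w ℓ) *
    (∏ ℓ, GG (w ℓ)) * (GG ((∑ ℓ, w ℓ) - 3 * (n : ℂ) / 2))⁻¹) * hc
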